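/- Let G = (V, E) be a graph, v ∈ V a vertex whose neighborhood is partitioned into three parts A, B, C with |B| = d, and let G' = (V ∪ {v'}, E') be the diamond d-split of G at v: E' is obtained from E by removing all edges {v, w} with w ∈ C and adding a new vertex v' with edges {v', w} for every w ∈ B ∪ C (and no edge {v, v'}). Let p : V → ℝ^d be positions such that the d vectors {p_u : u ∈ B} form a basis of ℝ^d, and let p' : V ∪ {v'} → ℝ^d extend p by p'_{v'} = p_v. Then the corank of E with respect to the hyperconnectivity matrix H(p) equals the corank of E' with respect to H(p'): |E| minus the dimension of the span of the rows of H(p) indexed by E equals |E'| minus the dimension of the span of the rows of H(p') indexed by E'. In particular, if the rows of H(p) indexed by E are linearly independent, then the rows of H(p') indexed by E' are linearly independent. -/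

import Mathlib

/-- Row of the hyperconnectivity matrix indexed by the ordered pair `e = (i, j)`:
block `i` contains `p j`, block `j` contains `-p i`, other blocks are zero. -/
def hypRow {n d : ℕ} (p : Fin n → Fin d → ℝ) (e : Fin n × Fin n) :
    Fin n → Fin d → ℝ :=
  fun k => if k = e.1 then p e.2 else if k = e.2 then -p e.1 else 0

lemma hypRow_swap {n d : ℕ} (p : Fin n → Fin d → ℝ) (a b : Fin n) (h : a ≠ b) :
    hypRow p (a, b) = - hypRow p (b, a) := by
  funext k
  simp only [hypRow, Pi.neg_apply]
  by_cases h1 : k = a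
  · subst h1; simp [h]
  · by_cases h2 : k = b
    · subst h2; simp [h1]
    · simp [h1, h2]

/-- Add the last block to block `v`. -/
def contractMap {m : ℕ} (d : ℕ) (v : Fin m) :
    (Fin (m + 1) → Fin d → ℝ) →ₗ[ℝ] (Fin m → Fin d → ℝ) where
  toFun x := fun k => x (Fin.castSucc k) + if k = v then x (Fin.last m) else 0
  map_add' x y := by
    funext k; by_cases h : k = v <;> simp [h]; abel
  map_smul' c x := by
    funext k; by_cases h : k = v <;> simp [h]

/-- Embedding of the kernel. -/
def kerMap {m : ℕ} (d : ℕ) (v : Fin m) :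
    (Fin d → ℝ) →ₗ[ℝ] (Fin (m + 1) → Fin d → ℝ) where
  toFun x := fun k => if k = Fin.castSucc v then x else if k = Fin.last m then -x else 0
  map_add' x y := by
    funext k
    by_cases h : k = Fin.castSucc v
    · simp [h]
    · by_cases h' : k = Fin.last m <;> simp [h, h']
      split_ifs <;> simp [add_comm]
  map_smul' c x := by
    funext k
    by_cases h : k = Fin.castSucc v
    · simp [h]
    · by_cases h' : k = Fin.last m <;> simp [h, h']

lemma range_kerMap {m d : ℕ} (v : Fin m) :
    LinearMap.range (kerMap d v) = LinearMap.ker (contractMap d v) := by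
  have hne : Fin.last m ≠ Fin.castSucc v := (Fin.castSucc_lt_last v).ne'
  have hl : ∀ k : Fin m, Fin.castSucc k ≠ Fin.last m := fun k => (Fin.castSucc_lt_last k).ne
  ext x
  rw [LinearMap.mem_range, LinearMap.mem_ker]
  constructor
  · rintro ⟨y, rfl⟩
    funext k
    by_cases h : k = v
    · subst h; simp [contractMap, kerMap, hne]
    · simp [contractMap, kerMap, h, hl]
  · intro hx
    have hk : ∀ k, x (Fin.castSucc k) + (if k = v then x (Fin.last m) else 0) = 0 :=
      fun k => congrFun hx k
    refine ⟨x (Fin.castSucc v), ?_⟩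
    funext k
    refine Fin.lastCases ?_ (fun j => ?_) k
    · have := hk v
      simp only [if_true] at this
      simp only [kerMap, LinearMap.coe_mk, AddHom.coe_mk, hne, if_false, if_true]
      exact neg_eq_of_add_eq_zero_right this
    · by_cases h : j = v
      · subst h; simp [kerMap]
      · have := hk j
        simp only [h, if_false, add_zero] at this
        simp [kerMap, h, hl, this]

lemma finrank_kerMap {m d : ℕ} (v : Fin m) :
    Module.finrank ℝ (LinearMap.ker (contractMap d v)) = d := by
  rw [← range_kerMap, LinearMap.finrank_range_of_inj]
  · simp
  · intro x y h
    have := congrFun h (Fin.castSucc v)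
    simpa [kerMap] using this

lemma finrank_of_ker_le {V W : Type*} [AddCommGroup V] [Module ℝ V] [FiniteDimensional ℝ V]
    [AddCommGroup W] [Module ℝ W] (T : V →ₗ[ℝ] W) (S : Submodule ℝ V)
    (h : LinearMap.ker T ≤ S) :
    Module.finrank ℝ S = Module.finrank ℝ (S.map T) + Module.finrank ℝ (LinearMap.ker T) := by
  rw [← LinearMap.finrank_range_add_finrank_ker (T.domRestrict S), LinearMap.range_domRestrict,
    LinearMap.ker_domRestrict]
  congr 1
  exact (Submodule.comapSubtypeEquivOfLe h).finrank_eq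

lemma contract_old {m d : ℕ} (v : Fin m) (p : Fin m → Fin d → ℝ) (a b : Fin m) :
    contractMap d v (hypRow (Fin.snoc p (p v) : Fin (m + 1) → Fin d → ℝ)
      (Fin.castSucc a, Fin.castSucc b)) = hypRow p (a, b) := by
  have hl : ∀ k : Fin m, Fin.last m ≠ Fin.castSucc k := fun k => (Fin.castSucc_lt_last k).ne'
  funext k
  simp [contractMap, hypRow, hl]

lemma contract_new {m d : ℕ} (v : Fin m) (p : Fin m → Fin d → ℝ) (w : Fin m) (hw : w ≠ v) :
    contractMap d v (hypRow (Fin.snoc p (p v) : Fin (m + 1) → Fin d → ℝ)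
      (Fin.castSucc w, Fin.last m)) = hypRow p (w, v) := by
  have hl : ∀ k : Fin m, Fin.last m ≠ Fin.castSucc k := fun k => (Fin.castSucc_lt_last k).ne'
  funext k
  by_cases h : k = v
  · subst h; simp [contractMap, hypRow, hl, (hl _).symm, hw.symm]
  · simp [contractMap, hypRow, (hl _).symm, h]

lemma kerMap_eq {m d : ℕ} (v : Fin m) (p : Fin m → Fin d → ℝ) (w : Fin m) (hw : w ≠ v) :
    kerMap d v (p w) =
      hypRow (Fin.snoc p (p v) : Fin (m + 1) → Fin d → ℝ) (Fin.castSucc w, Fin.last m)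
      - hypRow (Fin.snoc p (p v) : Fin (m + 1) → Fin d → ℝ)
        (Fin.castSucc w, Fin.castSucc v) := by
  have hl : ∀ k : Fin m, Fin.last m ≠ Fin.castSucc k := fun k => (Fin.castSucc_lt_last k).ne'
  funext k
  refine Fin.lastCases ?_ (fun j => ?_) k
  · simp [kerMap, hypRow, hl]
  · by_cases h : j = v
    · subst h; simp [kerMap, hypRow, (hl _).symm, hw.symm]
    · by_cases h' : j = w
      · subst h'; simp [kerMap, hypRow, (hl _).symm, h]
      · simp [h', kerMap, hypRow, (hl _).symm, h]

/-- Diamond `d`-split: let `v` be a vertex whose neighborhood is partitioned into `A`,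
`B`, `C` with `|B| = d`, and let `G'` (on the vertex set enlarged by the new vertex
`v' = Fin.last m`) be obtained by removing the edges from `v` to `C` and joining `v'` to
`B ∪ C` (with no edge between `v` and `v'`).  If `{p_u : u ∈ B}` is a basis of `ℝ^d`,
and `v'` is placed at `p_v`, then the corank of `E` in the hyperconnectivity matroid of
`p` equals the corank of `E'` in that of `p'`; in particular a diamond split of an
independent graph is independent. -/
theorem diamondSplit_corank_hyperconnectivity
    (d m : ℕ) (hd : 1 ≤ d) (v : Fin m)
    (E : Finset (Fin m × Fin m)) (hE : ∀ e ∈ E, e.1 < e.2)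
    (A B C : Finset (Fin m))
    (hnbhd : ∀ w : Fin m, (w ∈ A ∪ B ∪ C) ↔ ((v, w) ∈ E ∨ (w, v) ∈ E))
    (hAB : Disjoint A B) (hAC : Disjoint A C) (hBC : Disjoint B C)
    (hBcard : B.card = d)
    (p : Fin m → Fin d → ℝ)
    (hbasis_indep : LinearIndependent ℝ (fun u : ↥B => p u.1))
    (hbasis_span : Submodule.span ℝ (p '' ↑B) = ⊤)
    (p' : Fin (m + 1) → Fin d → ℝ) (hp' : p' = Fin.snoc p (p v))
    (E' : Finset (Fin (m + 1) × Fin (m + 1)))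
    (hE' : E' =
      ((E.filter (fun e => ¬(e.1 = v ∧ e.2 ∈ C) ∧ ¬(e.2 = v ∧ e.1 ∈ C))).image
          (fun e => (Fin.castSucc e.1, Fin.castSucc e.2)))
        ∪ ((B ∪ C).image (fun w => (Fin.castSucc w, Fin.last m)))) :
    (E.card - Module.finrank ℝ
        ↥(Submodule.span ℝ (hypRow p '' (E : Set (Fin m × Fin m)))) =
      E'.card - Module.finrank ℝ
        ↥(Submodule.span ℝ (hypRow p' '' (E' : Set (Fin (m + 1) × Fin (m + 1)))))) ∧
    (LinearIndependent ℝ (fun e : ↥(E : Set (Fin m × Fin m)) => hypRow p e.1) →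
      LinearIndependent ℝ
        (fun e : ↥(E' : Set (Fin (m + 1) × Fin (m + 1))) => hypRow p' e.1)) := by
  subst hp' hE'
  set p' : Fin (m + 1) → Fin d → ℝ := Fin.snoc p (p v) with hp'
  set F := E.filter (fun e => ¬(e.1 = v ∧ e.2 ∈ C) ∧ ¬(e.2 = v ∧ e.1 ∈ C)) with hF
  set E' := (F.image (fun e => (Fin.castSucc e.1, Fin.castSucc e.2)))
        ∪ ((B ∪ C).image (fun w => (Fin.castSucc w, Fin.last m))) with hE'
  have hnv : ∀ w, ((v, w) ∈ E ∨ (w, v) ∈ E) → w ≠ v := by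
    rintro w (h | h) rfl
    · exact absurd (hE _ h) (lt_irrefl _)
    · exact absurd (hE _ h) (lt_irrefl _)
  have hadj : ∀ w ∈ B ∪ C, ((v, w) ∈ E ∨ (w, v) ∈ E) := by
    intro w hw
    rw [← hnbhd]
    simp only [Finset.mem_union] at hw ⊢
    tauto
  have hBCv : ∀ w ∈ B ∪ C, w ≠ v := fun w hw => hnv w (hadj w hw)
  -- cardinalities
  have hcard : E'.card = E.card + d := by
    have h1 : E'.card = F.card + (B ∪ C).card := by
      rw [hE', Finset.card_union_of_disjoint, Finset.card_image_of_injective,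
        Finset.card_image_of_injective]
      · intro a b h
        simpa using h
      · rintro ⟨a, b⟩ ⟨a', b'⟩ h
        simpa using h
      · rw [Finset.disjoint_left]
        intro x hx hx'
        simp only [Finset.mem_image] at hx hx'
        obtain ⟨a, _, rfl⟩ := hx
        obtain ⟨w, _, h⟩ := hx'
        have := congrArg Prod.snd h
        exact (Fin.castSucc_lt_last a.2).ne this.symm
    have h2 : (E.filter (fun e => ¬ (¬(e.1 = v ∧ e.2 ∈ C) ∧ ¬(e.2 = v ∧ e.1 ∈ C)))).card
        = C.card := by
      symm
      refine Finset.card_bij (fun w _ => if v < w then (v, w) else (w, v)) ?_ ?_ ?_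
      · intro w hw
        have h := hadj w (Finset.mem_union_right _ hw)
        by_cases hlt : v < w
        · have : (v, w) ∈ E := h.resolve_right (fun h' => absurd (hE _ h') (lt_asymm hlt))
          simp [hlt, this, hw]
        · have : (w, v) ∈ E := h.resolve_left (fun h' => hlt (hE _ h'))
          simp [hlt, this, hw]
      · intro a ha b hb hab
        have ha' := hBCv a (Finset.mem_union_right _ ha)
        have hb' := hBCv b (Finset.mem_union_right _ hb)
        split_ifs at hab <;> simp only [Prod.mk.injEq] at hab <;> grind
      · rintro ⟨a, b⟩ hab
        rw [Finset.mem_filter] at hab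
        obtain ⟨he, hc⟩ := hab
        have hlt := hE _ he
        dsimp only at hc hlt
        by_cases h : a = v ∧ b ∈ C
        · obtain ⟨rfl, hb⟩ := h
          exact ⟨b, hb, by simp [hlt]⟩
        · have : b = v ∧ a ∈ C := by tauto
          obtain ⟨rfl, ha⟩ := this
          exact ⟨a, ha, by simp [hlt.le]⟩
    have h3 := Finset.card_filter_add_card_filter_not (s := E)
      (fun e => ¬(e.1 = v ∧ e.2 ∈ C) ∧ ¬(e.2 = v ∧ e.1 ∈ C))
    rw [h2, ← hF] at h3
    rw [h1, Finset.card_union_of_disjoint hBC, hBcard]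
    omega
  set S := Submodule.span ℝ (hypRow p '' (E : Set (Fin m × Fin m))) with hS
  set S' := Submodule.span ℝ (hypRow p' '' (E' : Set (Fin (m + 1) × Fin (m + 1)))) with hS'
  have memS : ∀ e ∈ E, hypRow p e ∈ S := fun e he =>
    Submodule.subset_span ⟨e, he, rfl⟩
  have memS' : ∀ e ∈ E', hypRow p' e ∈ S' := fun e he =>
    Submodule.subset_span ⟨e, he, rfl⟩
  have oldE' : ∀ e ∈ F, (Fin.castSucc e.1, Fin.castSucc e.2) ∈ E' := fun e he =>
    Finset.mem_union_left _ (Finset.mem_image_of_mem _ he)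
  have newE' : ∀ w ∈ B ∪ C, (Fin.castSucc w, Fin.last m) ∈ E' := fun w hw =>
    Finset.mem_union_right _
      (Finset.mem_image_of_mem (fun w : Fin m => (Fin.castSucc w, Fin.last m)) hw)
  have hker : LinearMap.ker (contractMap d v) ≤ S' := by
    rw [← range_kerMap, LinearMap.range_eq_map, Submodule.map_le_iff_le_comap, ← hbasis_span,
      Submodule.span_le]
    rintro _ ⟨w, hw, rfl⟩
    have hw : w ∈ B := hw
    have hwBC := Finset.mem_union_left C hw
    have hwv := hBCv w hwBC
    have hwC : w ∉ C := Finset.disjoint_left.1 hBC hw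
    have hvC : v ∉ C := fun h => hBCv v (Finset.mem_union_right _ h) rfl
    show kerMap d v (p w) ∈ S'
    rw [kerMap_eq v p w hwv]
    refine S'.sub_mem (memS' _ (newE' w hwBC)) ?_
    rcases hadj w hwBC with h | h
    · rw [hypRow_swap _ _ _ (fun h => hwv (Fin.castSucc_injective _ h))]
      refine S'.neg_mem (memS' _ (oldE' (v, w) ?_))
      simp [hF, h, hwC, hvC]
    · refine memS' _ (oldE' (w, v) ?_)
      simp [hF, h, hwC, hvC]
  have hmap : S'.map (contractMap d v) = S := by
    apply le_antisymm
    · rw [Submodule.map_le_iff_le_comap, hS', Submodule.span_le]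
      rintro _ ⟨e, he, rfl⟩
      show contractMap d v (hypRow p' e) ∈ S
      rcases Finset.mem_union.1 (Finset.mem_coe.1 he) with h | h
      · obtain ⟨a, ha, rfl⟩ := Finset.mem_image.1 h
        rw [hp', contract_old]
        exact memS _ (Finset.mem_filter.1 ha).1
      · obtain ⟨w, hw, rfl⟩ := Finset.mem_image.1 h
        rw [hp', contract_new v p w (hBCv w hw)]
        rcases hadj w hw with h | h
        · rw [hypRow_swap _ _ _ (hBCv w hw)]
          exact S.neg_mem (memS _ h)
        · exact memS _ h
    · rw [hS, Submodule.span_le]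
      rintro _ ⟨⟨a, b⟩, he, rfl⟩
      have he : (a, b) ∈ E := he
      have key : ∀ w ∈ C, hypRow p (w, v) ∈ S'.map (contractMap d v) := fun w hw =>
        ⟨_, memS' _ (newE' w (Finset.mem_union_right _ hw)),
          contract_new v p w (hBCv w (Finset.mem_union_right _ hw))⟩
      show hypRow p (a, b) ∈ S'.map (contractMap d v)
      by_cases h1 : a = v ∧ b ∈ C
      · obtain ⟨rfl, hb⟩ := h1
        rw [hypRow_swap _ _ _ (hBCv b (Finset.mem_union_right _ hb)).symm]
        exact Submodule.neg_mem _ (key b hb)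
      · by_cases h2 : b = v ∧ a ∈ C
        · obtain ⟨rfl, ha⟩ := h2
          exact key a ha
        · exact ⟨_, memS' _ (oldE' (a, b) (Finset.mem_filter.2 ⟨he, h1, h2⟩)),
            contract_old v p a b⟩
  have hrank : Module.finrank ℝ S' = Module.finrank ℝ S + d := by
    rw [finrank_of_ker_le (contractMap d v) S' hker, hmap, finrank_kerMap]
  refine ⟨by rw [hcard, hrank]; omega, ?_⟩
  rw [linearIndependent_iff_card_eq_finrank_span, linearIndependent_iff_card_eq_finrank_span]
  have r1 : Set.range (fun e : ↥(E : Set (Fin m × Fin m)) => hypRow p e.1)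
      = hypRow p '' (E : Set (Fin m × Fin m)) := by
    rw [Set.image_eq_range]
  have r2 : Set.range (fun e : ↥(E' : Set (Fin (m + 1) × Fin (m + 1))) => hypRow p' e.1)
      = hypRow p' '' (E' : Set (Fin (m + 1) × Fin (m + 1))) := by
    rw [Set.image_eq_range]
  rw [r1, r2]
  unfold Set.finrank
  intro h
  have c1 : Fintype.card ↥(E : Set (Fin m × Fin m)) = E.card := by simp
  have c2 : Fintype.card ↥(E' : Set (Fin (m + 1) × Fin (m + 1))) = E'.card := by
    rw [← Set.toFinset_card, Finset.toFinset_coe]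
  rw [c1] at h
  rw [c2, hcard, h]
  exact hrank.symm
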